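/- Let n ≥ 1 be an integer, let θ = (θ_i)_{i≥1} be a square-summable real sequence, let a = (a_i)_{i≥1} be absolutely summable and c ∈ ℝ. Then the risk of the diagonal quadratic estimator Q̂(y) = Σ_{i≥1} a_i y_i² + c satisfies E_θ(Q̂ − Q(θ))² = (Σ_{i≥1} a_i θ_i² + (1/n) Σ_{i≥1} a_i + c − Σ_{i≥1} θ_i²)² + (4/n) Σ_{i≥1} a_i² θ_i² + (2/n²) Σ_{i≥1} a_i². -/

import Mathlib

open MeasureTheory ProbabilityTheory Real Filter
open scoped NNReal ENNReal Topology

/-- `P` is the infinite product measure `⊗_{i≥0} N(θ_i, 1/n)` on the sequence space `ℕ → ℝ`: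
a probability measure whose value on every measurable cylinder set is the corresponding
finite product of Gaussian probabilities. -/
def IsGaussianSeqMeasure (n : ℕ) (θ : ℕ → ℝ) (P : Measure (ℕ → ℝ)) : Prop :=
  IsProbabilityMeasure P ∧
    ∀ s : Finset ℕ, ∀ A : ℕ → Set ℝ, (∀ i, MeasurableSet (A i)) →
      P {y | ∀ i ∈ s, y i ∈ A i} = ∏ i ∈ s, gaussianReal (θ i) ((n : ℝ≥0))⁻¹ (A i)

/-- The quadratic functional `Q(θ) = ∑ θ_i²`. -/
noncomputable def Qfun (θ : ℕ → ℝ) : ℝ := ∑' i, (θ i) ^ 2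

/-- The risk `E_θ (δ - Q(θ))²`, valued in `[0,∞]`. -/
noncomputable def risk (P : Measure (ℕ → ℝ)) (δ : (ℕ → ℝ) → ℝ) (θ : ℕ → ℝ) : ℝ≥0∞ :=
  ∫⁻ y, ENNReal.ofReal ((δ y - Qfun θ) ^ 2) ∂P

theorem iteratedDeriv_mgf_id_gaussianReal (μ : ℝ) (v : ℝ≥0) :
    iteratedDeriv 2 (mgf id (gaussianReal μ v)) 0 = μ ^ 2 + v ∧
    iteratedDeriv 4 (mgf id (gaussianReal μ v)) 0 = μ ^ 4 + 6 * v * μ ^ 2 + 3 * (v : ℝ) ^ 2 := by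
  have hp (t : ℝ) : HasDerivAt (fun t ↦ μ + v * t) v t := by
    simpa using ((hasDerivAt_id t).const_mul (v : ℝ)).const_add μ
  have he (t : ℝ) : HasDerivAt (fun t ↦ rexp (μ * t + v * t ^ 2 / 2))
      (rexp (μ * t + v * t ^ 2 / 2) * (μ + v * t)) t := by
    refine HasDerivAt.exp ?_
    refine (((hasDerivAt_id t).const_mul μ).add
      ((((hasDerivAt_id t).pow 2).const_mul (v : ℝ)).div_const 2)).congr_deriv ?_
    simp; ring
  have h1 : deriv (fun t ↦ rexp (μ * t + v * t ^ 2 / 2)) =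
      fun t ↦ rexp (μ * t + v * t ^ 2 / 2) * (μ + v * t) := funext fun t ↦ (he t).deriv
  have h2 : deriv (fun t ↦ rexp (μ * t + v * t ^ 2 / 2) * (μ + v * t)) =
      fun t ↦ rexp (μ * t + v * t ^ 2 / 2) * ((μ + v * t) ^ 2 + v) := by
    funext t
    refine (((he t).mul (hp t)).deriv).trans ?_
    ring
  have h3 : deriv (fun t ↦ rexp (μ * t + v * t ^ 2 / 2) * ((μ + v * t) ^ 2 + v)) =
      fun t ↦ rexp (μ * t + v * t ^ 2 / 2) * ((μ + v * t) ^ 3 + 3 * v * (μ + v * t)) := by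
    funext t
    refine (((he t).mul (((hp t).pow 2).add_const (v : ℝ))).deriv).trans ?_
    simp; ring
  have h4 : deriv (fun t ↦ rexp (μ * t + v * t ^ 2 / 2) *
        ((μ + v * t) ^ 3 + 3 * v * (μ + v * t))) =
      fun t ↦ rexp (μ * t + v * t ^ 2 / 2) *
        ((μ + v * t) ^ 4 + 6 * v * (μ + v * t) ^ 2 + 3 * (v : ℝ) ^ 2) := by
    funext t
    refine (((he t).mul (((hp t).pow 3).add ((hp t).const_mul (3 * (v : ℝ))))).deriv).trans ?_
    simp; ring
  rw [mgf_id_gaussianReal]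
  simp [iteratedDeriv_succ, h1, h2, h3, h4]

theorem integral_sq_gaussianReal (μ : ℝ) (v : ℝ≥0) :
    ∫ x, x ^ 2 ∂gaussianReal μ v = μ ^ 2 + v := by
  rw [← (iteratedDeriv_mgf_id_gaussianReal μ v).1, iteratedDeriv_mgf_zero (by simp)]
  simp

theorem integral_pow_four_gaussianReal (μ : ℝ) (v : ℝ≥0) :
    ∫ x, x ^ 4 ∂gaussianReal μ v = μ ^ 4 + 6 * v * μ ^ 2 + 3 * (v : ℝ) ^ 2 := by
  rw [← (iteratedDeriv_mgf_id_gaussianReal μ v).2, iteratedDeriv_mgf_zero (by simp)]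
  simp

theorem memLp_sq_gaussianReal (μ : ℝ) (v : ℝ≥0) :
    MemLp (fun x ↦ x ^ 2) 2 (gaussianReal μ v) := by
  rw [memLp_two_iff_integrable_sq (by fun_prop)]
  have h := (memLp_id_gaussianReal (μ := μ) (v := v) 4).integrable_norm_pow (by simp)
  refine h.congr (ae_of_all _ fun x ↦ ?_)
  simp only [id, Real.norm_eq_abs]
  rw [← pow_mul]
  exact Even.pow_abs (by decide) x

theorem variance_sq_gaussianReal (μ : ℝ) (v : ℝ≥0) :
    Var[fun x ↦ x ^ 2; gaussianReal μ v] = 4 * v * μ ^ 2 + 2 * (v : ℝ) ^ 2 := by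
  rw [variance_eq_sub (memLp_sq_gaussianReal μ v), integral_sq_gaussianReal]
  have h : ∫ x, ((fun x : ℝ ↦ x ^ 2) ^ 2) x ∂gaussianReal μ v = _ :=
    (integral_congr_ae (ae_of_all _ fun x ↦ by simp; ring)).trans
      (integral_pow_four_gaussianReal μ v)
  rw [h]
  ring

theorem summable_sq_of_summable_abs {ι : Type*} {a : ι → ℝ} (ha : Summable fun i ↦ |a i|) :
    Summable fun i ↦ a i ^ 2 := by
  refine (ha.mul_right (∑' i, |a i|)).of_nonneg_of_le (fun i ↦ sq_nonneg _) fun i ↦ ?_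
  rw [← sq_abs, sq]
  exact mul_le_mul_of_nonneg_left (ha.le_tsum i fun j _ ↦ abs_nonneg _) (abs_nonneg _)

theorem exists_integrable_hasSum_norm {Ω : Type*} {mΩ : MeasurableSpace Ω} {μ : Measure Ω}
    {F : ℕ → Ω → ℝ} (hF : ∀ i, Integrable (F i) μ) (hsum : Summable fun i ↦ ∫ ω, ‖F i ω‖ ∂μ) :
    ∃ B : Ω → ℝ, Integrable B μ ∧ ∀ᵐ ω ∂μ, HasSum (fun i ↦ ‖F i ω‖) (B ω) := by
  have hm : AEMeasurable (fun ω ↦ ∑' i, ‖F i ω‖ₑ) μ :=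
    AEMeasurable.tsum fun i ↦ (hF i).aestronglyMeasurable.enorm
  have hfin : ∫⁻ ω, ∑' i, ‖F i ω‖ₑ ∂μ ≠ ∞ := by
    rw [lintegral_tsum fun i ↦ (hF i).aestronglyMeasurable.enorm]
    simp_rw [← fun i ↦ ofReal_integral_norm_eq_lintegral_enorm (hF i)]
    exact hsum.tsum_ofReal_ne_top
  refine ⟨fun ω ↦ (∑' i, ‖F i ω‖ₑ).toReal, integrable_toReal_of_lintegral_ne_top hm hfin, ?_⟩
  filter_upwards [ae_lt_top' hm hfin] with ω hω
  have h := ENNReal.hasSum_toReal hω.ne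
  rw [← ENNReal.tsum_toReal_eq fun i ↦ enorm_ne_top] at h
  simpa using h

theorem integral_sq_tsum_mul_add {Ω : Type*} {mΩ : MeasurableSpace Ω} {μ : Measure Ω}
    [IsProbabilityMeasure μ] {X : ℕ → Ω → ℝ} (hX : ∀ i, MemLp (X i) 2 μ)
    (hind : iIndepFun X μ) {M : ℝ} (hM : ∀ i, ∫ ω, X i ω ^ 2 ∂μ ≤ M)
    {a : ℕ → ℝ} (ha : Summable fun i ↦ |a i|) (d : ℝ) :
    Integrable (fun ω ↦ (∑' i, a i * X i ω + d) ^ 2) μ ∧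
    ∫ ω, (∑' i, a i * X i ω + d) ^ 2 ∂μ =
      (∑' i, a i * μ[X i] + d) ^ 2 + ∑' i, a i ^ 2 * Var[X i; μ] := by
  have hvar (i : ℕ) : Var[X i; μ] = ∫ ω, X i ω ^ 2 ∂μ - μ[X i] ^ 2 := variance_eq_sub (hX i)
  have hmean (i : ℕ) : |μ[X i]| ≤ 1 + M := by
    have h1 := hM i
    have h2 := hvar i ▸ variance_nonneg (X i) μ
    exact abs_le_of_sq_le_sq (by nlinarith) (by nlinarith)
  have hvarM (i : ℕ) : Var[X i; μ] ≤ M := by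
    rw [hvar]
    nlinarith [hM i, sq_nonneg μ[X i]]
  have hsum_mean : Summable fun i ↦ a i * μ[X i] := by
    refine (ha.mul_right (1 + M)).of_norm_bounded fun i ↦ ?_
    rw [norm_mul]
    exact mul_le_mul_of_nonneg_left (hmean i) (norm_nonneg _)
  have hsum_var : Summable fun i ↦ a i ^ 2 * Var[X i; μ] := by
    have hsq : Summable fun i ↦ a i ^ 2 := summable_sq_of_summable_abs ha
    refine (hsq.mul_right M).of_nonneg_of_le
      (fun i ↦ mul_nonneg (sq_nonneg _) (variance_nonneg _ _)) fun i ↦ ?_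
    exact mul_le_mul_of_nonneg_left (hvarM i) (sq_nonneg _)
  obtain ⟨B, hB, hBsum⟩ := exists_integrable_hasSum_norm (μ := μ)
    (F := fun i ω ↦ a i * X i ω ^ 2) (fun i ↦ (hX i).integrable_sq.const_mul _) <| by
      refine (ha.mul_right M).of_nonneg_of_le
        (fun i ↦ integral_nonneg fun ω ↦ norm_nonneg _) fun i ↦ ?_
      simp only [norm_mul, norm_pow, Real.norm_eq_abs, sq_abs, integral_const_mul]
      exact mul_le_mul_of_nonneg_left (hM i) (abs_nonneg _)
  set S : ℕ → Ω → ℝ := fun N ω ↦ ∑ i ∈ Finset.range N, a i * X i ω with hS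
  have haX (i : ℕ) : MemLp (fun ω ↦ a i * X i ω) 2 μ := (hX i).const_mul _
  have hSL (N : ℕ) : MemLp (S N) 2 μ := memLp_finsetSum _ fun i _ ↦ haX i
  have hSint (N : ℕ) : ∫ ω, (S N ω + d) ^ 2 ∂μ =
      (∑ i ∈ Finset.range N, a i * μ[X i] + d) ^ 2 +
        ∑ i ∈ Finset.range N, a i ^ 2 * Var[X i; μ] := by
    have h1 : Var[fun ω ↦ S N ω + d; μ] = ∑ i ∈ Finset.range N, a i ^ 2 * Var[X i; μ] := by
      rw [variance_add_const (hSL N).aestronglyMeasurable]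
      have : S N = ∑ i ∈ Finset.range N, fun ω ↦ a i * X i ω := by
        ext ω; simp [hS]
      rw [this, IndepFun.variance_sum (fun i _ ↦ haX i)]
      · simp_rw [variance_const_mul]
      · intro i _ j _ hij
        exact (hind.indepFun hij).comp (measurable_const_mul (a i)) (measurable_const_mul (a j))
    have h2 : ∫ ω, S N ω + d ∂μ = ∑ i ∈ Finset.range N, a i * μ[X i] + d := by
      rw [integral_add ((hSL N).integrable one_le_two) (integrable_const _),
        integral_finsetSum _ fun i _ ↦ (haX i).integrable one_le_two]
      simp [integral_const_mul]
    have h3 := variance_eq_sub ((hSL N).add (memLp_const d))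
    rw [← h1, ← h2]
    have h4 : Var[fun ω ↦ S N ω + d; μ] =
      ∫ ω, (S N ω + d) ^ 2 ∂μ - (∫ ω, S N ω + d ∂μ) ^ 2 := h3
    linarith
  set A := ∑' i, |a i|
  have hbound (N : ℕ) : ∀ᵐ ω ∂μ, ‖(S N ω + d) ^ 2‖ ≤ 2 * (A * B ω) + 2 * d ^ 2 := by
    filter_upwards [hBsum] with ω hω
    have hcs : S N ω ^ 2 ≤ A * B ω := by
      refine (Finset.sum_sq_le_sum_mul_sum_of_sq_le_mul _
        (f := fun i ↦ |a i|) (g := fun i ↦ ‖a i * X i ω ^ 2‖)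
        (fun i _ ↦ abs_nonneg _) (fun i _ ↦ norm_nonneg _) fun i _ ↦ le_of_eq ?_).trans ?_
      · rw [norm_mul, norm_pow, Real.norm_eq_abs, Real.norm_eq_abs, sq_abs, ← mul_assoc,
          ← sq, sq_abs, mul_pow]
      · exact mul_le_mul (ha.sum_le_tsum _ fun i _ ↦ abs_nonneg _)
          (sum_le_hasSum _ (fun i _ ↦ norm_nonneg _) hω)
          (Finset.sum_nonneg fun i _ ↦ norm_nonneg _) (tsum_nonneg fun i ↦ abs_nonneg _)
    rw [Real.norm_of_nonneg (sq_nonneg _)]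
    nlinarith [sq_nonneg (S N ω - d)]
  have hlim : ∀ᵐ ω ∂μ, Tendsto (fun N ↦ (S N ω + d) ^ 2) atTop
      (𝓝 ((∑' i, a i * X i ω + d) ^ 2)) := by
    filter_upwards [hBsum] with ω hω
    have hs : Summable fun i ↦ a i * X i ω := by
      refine (ha.add hω.summable).of_norm_bounded fun i ↦ ?_
      simp only [norm_mul, norm_pow, Real.norm_eq_abs, sq_abs]
      have : |X i ω| ≤ 1 + X i ω ^ 2 := by nlinarith [sq_nonneg (|X i ω| - 1), sq_abs (X i ω)]
      nlinarith [abs_nonneg (a i)]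
    exact (hs.hasSum.tendsto_sum_nat.add_const d).pow 2
  have hmeas (N : ℕ) : AEStronglyMeasurable (fun ω ↦ (S N ω + d) ^ 2) μ :=
    ((hSL N).aestronglyMeasurable.add_const d).pow 2
  have hBi : Integrable (fun ω ↦ 2 * (A * B ω) + 2 * d ^ 2) μ :=
    ((hB.const_mul A).const_mul 2).add (integrable_const _)
  constructor
  · refine hBi.mono' (aestronglyMeasurable_of_tendsto_ae _ hmeas hlim) ?_
    filter_upwards [hlim, ae_all_iff.2 hbound] with ω h1 h2
    exact le_of_tendsto h1.norm (Eventually.of_forall h2)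
  · refine tendsto_nhds_unique
      (tendsto_integral_of_dominated_convergence _ hmeas hBi hbound hlim) ?_
    simp_rw [hSint]
    exact ((hsum_mean.hasSum.tendsto_sum_nat.add_const d).pow 2).add
      hsum_var.hasSum.tendsto_sum_nat

/-- the risk of the diagonal quadratic estimator
`Q̂(y) = ∑ a_i y_i² + c` under the Gaussian sequence model. -/
theorem risk_diagonal_quadratic (n : ℕ) (hn : 1 ≤ n) (θ : ℕ → ℝ)
    (hθ : Summable fun i => (θ i) ^ 2) (a : ℕ → ℝ) (ha : Summable fun i => |a i|)
    (c : ℝ) (P : Measure (ℕ → ℝ)) (hP : IsGaussianSeqMeasure n θ P) :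
    risk P (fun y => (∑' i, a i * (y i) ^ 2) + c) θ =
      ENNReal.ofReal
        (((∑' i, a i * (θ i) ^ 2) + (1 / n) * (∑' i, a i) + c - ∑' i, (θ i) ^ 2) ^ 2
          + (4 / n) * (∑' i, (a i) ^ 2 * (θ i) ^ 2)
          + (2 / (n : ℝ) ^ 2) * (∑' i, (a i) ^ 2)) := by
  set v : ℝ≥0 := (n : ℝ≥0)⁻¹ with hv
  have hvn : (v : ℝ) = 1 / n := by simp [hv]
  have hPeq : P = Measure.infinitePi fun i ↦ gaussianReal (θ i) v :=
    Measure.eq_infinitePi _ fun s A hA ↦ hP.2 s A hA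
  have hmp (i : ℕ) : MeasurePreserving (fun y : ℕ → ℝ ↦ y i) P (gaussianReal (θ i) v) :=
    hPeq ▸ measurePreserving_eval_infinitePi (fun i ↦ gaussianReal (θ i) v) i
  have := hP.1
  have hX (i : ℕ) : MemLp (fun y : ℕ → ℝ ↦ y i ^ 2) 2 P :=
    (memLp_sq_gaussianReal (θ i) v).comp_measurePreserving (hmp i)
  have hind : iIndepFun (fun (i : ℕ) (y : ℕ → ℝ) ↦ y i ^ 2) P :=
    hPeq ▸ iIndepFun_infinitePi (X := fun _ x ↦ x ^ 2) fun _ ↦ by fun_prop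
  have hcoord (i : ℕ) (f : ℝ → ℝ) (hf : Measurable f) :
      ∫ y, f (y i) ∂P = ∫ x, f x ∂gaussianReal (θ i) v := by
    rw [← (hmp i).map_eq, integral_map (hmp i).aemeasurable hf.aestronglyMeasurable]
  have hmean (i : ℕ) : ∫ y, y i ^ 2 ∂P = θ i ^ 2 + v := by
    rw [hcoord i (fun x ↦ x ^ 2) (by fun_prop), integral_sq_gaussianReal]
  have hvar (i : ℕ) : Var[fun y : ℕ → ℝ ↦ y i ^ 2; P] = 4 * v * θ i ^ 2 + 2 * (v : ℝ) ^ 2 := by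
    rw [← variance_sq_gaussianReal, ← (hmp i).map_eq,
      variance_map (by fun_prop) (hmp i).aemeasurable]
    rfl
  set T := ∑' i, θ i ^ 2 with hT
  have hθT (i : ℕ) : θ i ^ 2 ≤ T := hθ.le_tsum i fun j _ ↦ sq_nonneg _
  have hM (i : ℕ) : ∫ y, (y i ^ 2) ^ 2 ∂P ≤ T ^ 2 + 6 * v * T + 3 * (v : ℝ) ^ 2 := by
    simp_rw [← pow_mul]
    rw [hcoord i (fun x ↦ x ^ (2 * 2)) (by fun_prop), integral_pow_four_gaussianReal]
    have h1 : θ i ^ 4 ≤ T ^ 2 := by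
      have := pow_le_pow_left₀ (sq_nonneg (θ i)) (hθT i) 2
      rwa [← pow_mul] at this
    have h2 := mul_le_mul_of_nonneg_left (hθT i) v.coe_nonneg
    linarith
  obtain ⟨hI, hE⟩ := integral_sq_tsum_mul_add hX hind hM ha (c - T)
  have hbd {b : ℕ → ℝ} (hb : Summable fun i ↦ |b i|) : Summable fun i ↦ b i * θ i ^ 2 := by
    refine (hb.mul_right T).of_norm_bounded fun i ↦ ?_
    rw [norm_mul, Real.norm_of_nonneg (sq_nonneg (θ i))]
    exact mul_le_mul_of_nonneg_left (hθT i) (norm_nonneg _)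
  have hasq : Summable fun i ↦ a i ^ 2 := summable_sq_of_summable_abs ha
  have hmeans : ∑' i, a i * (θ i ^ 2 + v) = ∑' i, a i * θ i ^ 2 + 1 / n * ∑' i, a i := by
    simp_rw [mul_add]
    rw [(hbd ha).tsum_add (ha.of_abs.mul_right _), tsum_mul_right, hvn, mul_comm (∑' i, a i)]
  have hvars : ∑' i, a i ^ 2 * (4 * v * θ i ^ 2 + 2 * (v : ℝ) ^ 2) =
      4 / n * ∑' i, a i ^ 2 * θ i ^ 2 + 2 / (n : ℝ) ^ 2 * ∑' i, a i ^ 2 := by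
    rw [← tsum_mul_left, ← tsum_mul_left,
      ← ((hbd hasq.abs).mul_left _).tsum_add (hasq.mul_left _)]
    refine tsum_congr fun i ↦ ?_
    rw [hvn]
    ring
  simp_rw [hmean, hvar, hmeans, hvars] at hE
  unfold risk Qfun
  simp_rw [← hT, add_sub_assoc]
  rw [← ofReal_integral_eq_lintegral_ofReal hI (ae_of_all _ fun y ↦ sq_nonneg _), hE]
  congr 1
  ring
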